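/- arXiv:1005.1297 — 3 statements merged into one kernel-verified Lean document; each statement's English description precedes it below -/
import Mathlib

section
/- Let D ≥ 2 and suppose n = 2^D − 2 or n = 2^D − 1. Then for all finite multisets I, J of natural numbers in {1, …, n} with Σ_{i∈I} i = Σ_{j∈J} j, the equality ∏_{i∈I} w_i = ∏_{j∈J} w_j holds in (ℤ/2)[x]/(x^{n+1}). -/
/-- The truncated polynomial ring `(ℤ/2)[x]/(x^(n+1))`, i.e. the mod 2 cohomology ring
of `ℝPⁿ`. -/
abbrev TruncRing (n : ℕ) : Type :=
  Polynomial (ZMod 2) ⧸ Ideal.span {(Polynomial.X : Polynomial (ZMod 2)) ^ (n + 1)}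

/-- `w n j` is the `j`-th Stiefel–Whitney class `C(n+1, j) * x^j` of the tangent bundle of
`ℝPⁿ`, viewed in `(ℤ/2)[x]/(x^(n+1))`. -/
noncomputable def w (n j : ℕ) : TruncRing n :=
  Ideal.Quotient.mk _ (Polynomial.C (((n + 1).choose j : ℕ) : ZMod 2) * Polynomial.X ^ j)

theorem Nat.odd_choose_two_pow_sub_one (D k : ℕ) (hk : k < 2 ^ D) :
    Odd ((2 ^ D - 1).choose k) := by
  induction k with
  | zero => simp
  | succ k ih =>
    have pascal : (2 ^ D).choose (k + 1) =
        (2 ^ D - 1).choose k + (2 ^ D - 1).choose (k + 1) := by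
      conv_lhs => rw [← Nat.sub_add_cancel (Nat.one_le_two_pow (n := D))]
      exact Nat.choose_succ_succ _ _
    have even : 2 ∣ (2 ^ D).choose (k + 1) :=
      Nat.prime_two.dvd_choose_pow (Nat.succ_ne_zero k) hk.ne
    have odd := ih (by omega)
    rw [Nat.odd_iff] at odd ⊢
    omega

theorem w_eq_zero_of_even {n j : ℕ} (h : 2 ∣ (n + 1).choose j) : w n j = 0 := by
  simp [w, (ZMod.natCast_eq_zero_iff _ _).2 h]

theorem w_eq_pow_of_odd {n j : ℕ} (h : Odd ((n + 1).choose j)) :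
    w n j = Ideal.Quotient.mk _ Polynomial.X ^ j := by
  simp [w, ZMod.natCast_eq_one_iff_odd.2 h]

/-- If `w n` vanishes in degrees `1, …, n`, every monomial of positive degree vanishes, so a
monomial is determined by its degree. -/
theorem prod_map_w_eq_ite {n : ℕ} (hw : ∀ i, 1 ≤ i → i ≤ n → w n i = 0)
    (I : Multiset ℕ) (hI : ∀ i ∈ I, 1 ≤ i ∧ i ≤ n) :
    (I.map (w n)).prod = if I.sum = 0 then 1 else 0 := by
  induction I using Multiset.induction_on with
  | empty => simp
  | cons a I _ =>
    obtain ⟨ha, han⟩ := hI a (Multiset.mem_cons_self a I)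
    have : a ≠ 0 := by omega
    simp [hw a ha han, this]

/-- If `w n i = x ^ i` in degrees `1, …, n`, a monomial is `x` to the power of its degree. -/
theorem prod_map_w_eq_pow_sum {n : ℕ} {x : TruncRing n}
    (hw : ∀ i, 1 ≤ i → i ≤ n → w n i = x ^ i)
    (I : Multiset ℕ) (hI : ∀ i ∈ I, 1 ≤ i ∧ i ≤ n) :
    (I.map (w n)).prod = x ^ I.sum := by
  rw [Multiset.map_congr rfl fun i hi => hw i (hI i hi).1 (hI i hi).2]
  induction I using Multiset.induction_on with
  | empty => simp
  | cons a I ih =>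
    simp [ih fun i hi => hI i (Multiset.mem_cons_of_mem hi), pow_add]

/-- Let `D ≥ 2` and `n = 2^D - 2` or `n = 2^D - 1`.  Then `∏_{i ∈ I} w_i = ∏_{j ∈ J} w_j`
holds in `H^*(ℝPⁿ; ℤ/2)` for all finite multisets `I, J` of natural numbers in `{1, …, n}`
with `Σ_{i ∈ I} i = Σ_{j ∈ J} j`. -/
theorem stmt5 (D n : ℕ) (hD : 2 ≤ D) (hn : n = 2 ^ D - 2 ∨ n = 2 ^ D - 1)
    (I J : Multiset ℕ)
    (hI : ∀ i ∈ I, 1 ≤ i ∧ i ≤ n) (hJ : ∀ j ∈ J, 1 ≤ j ∧ j ≤ n)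
    (hsum : I.sum = J.sum) :
    (I.map (w n)).prod = (J.map (w n)).prod := by
  have hpow : 2 ^ 2 ≤ 2 ^ D := Nat.pow_le_pow_right two_pos hD
  obtain hn | hn := hn
  · have hw (i : ℕ) (_ : 1 ≤ i) (hi : i ≤ n) :
        w n i = Ideal.Quotient.mk _ Polynomial.X ^ i := by
      apply w_eq_pow_of_odd
      rw [show n + 1 = 2 ^ D - 1 by omega]
      exact Nat.odd_choose_two_pow_sub_one D i (by omega)
    rw [prod_map_w_eq_pow_sum hw I hI, prod_map_w_eq_pow_sum hw J hJ, hsum]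
  · have hw (i : ℕ) (hpos : 1 ≤ i) (hi : i ≤ n) : w n i = 0 := by
      apply w_eq_zero_of_even
      rw [show n + 1 = 2 ^ D by omega]
      exact Nat.prime_two.dvd_choose_pow (by omega) (by omega)
    rw [prod_map_w_eq_ite hw I hI, prod_map_w_eq_ite hw J hJ, hsum]
end

section
/- Let n = 2^a + 2^b − 1 with integers a > b > 0. Then 𝓡₊ equals the ℤ/2-linear span of the monomials x^j·t^{n−2j} for those j with 1 ≤ j ≤ (n−1)/2, j ≠ 2^{a−1} and j ≠ 2^b. (When a = b+1 the two exceptional values coincide.) -/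
open MvPolynomial

/-- The polynomial `R_n(s, m) ∈ (ℤ/2)[x, t]` (with `x = X 0`, `t = X 1`):
`R_n(s,m) = Σ_i C(m,i)·C(s+1+m−i, n−2m−2i−2−s)·x^(m+1+i)·t^(n−2m−2i−2)`,
the sum running over `0 ≤ i ≤ m` with `n − 2m − 2i − 2 ≥ 0`, with the convention that a
binomial coefficient `C(α,β)` is `0` whenever `β < 0` or `α < β`. -/
noncomputable def Rpoly (n s m : ℕ) : MvPolynomial (Fin 2) (ZMod 2) :=
  ∑ i ∈ Finset.range (m + 1),
    if 2 * m + 2 * i + 2 ≤ n then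
      (if s ≤ n - (2 * m + 2 * i + 2) then
          ((m.choose i * (s + 1 + m - i).choose (n - (2 * m + 2 * i + 2) - s) : ℕ) : ZMod 2)
        else 0) •
        (X 0 ^ (m + 1 + i) * X 1 ^ (n - (2 * m + 2 * i + 2)))
    else 0

/-- `𝓡₊`: the `ℤ/2`-linear span of the polynomials `R_n(s, m)` for `(s, m) ∈ V_R`,
i.e. `s, m ≥ 0` and `s + 2m + 2 ≤ n - 1`. -/
noncomputable def Rplus (n : ℕ) : Submodule (ZMod 2) (MvPolynomial (Fin 2) (ZMod 2)) :=
  Submodule.span (ZMod 2) {p | ∃ s m : ℕ, s + 2 * m + 2 ≤ n - 1 ∧ p = Rpoly n s m}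

/-- `R₀ = Σ_{1 ≤ j ≤ n/2} C(n−j−1, n−2j)·x^j·t^(n−2j) ∈ (ℤ/2)[x, t]`. -/
noncomputable def Rzero (n : ℕ) : MvPolynomial (Fin 2) (ZMod 2) :=
  ∑ j ∈ Finset.Icc 1 (n / 2),
    (((n - j - 1).choose (n - 2 * j) : ℕ) : ZMod 2) • (X 0 ^ j * X 1 ^ (n - 2 * j))

theorem Nat.choose_two_mul_add_modEq (n k e f : ℕ) (he : e < 2) (hf : f < 2) :
    (2 * n + e).choose (2 * k + f) ≡ e.choose f * n.choose k [MOD 2] := by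
  have h := Choose.choose_modEq_choose_mod_mul_choose_div_nat
    (n := 2 * n + e) (k := 2 * k + f) (p := 2)
  rwa [show (2 * n + e) % 2 = e by omega, show (2 * k + f) % 2 = f by omega,
    show (2 * n + e) / 2 = n by omega, show (2 * k + f) / 2 = k by omega] at h

theorem Nat.two_dvd_choose_two_pow_sub_one_sub (k q r : ℕ) (hr : 1 ≤ r) (hrk : r < 2 ^ k) :
    2 ∣ (2 ^ k * q + (2 ^ k - 1 - r)).choose r := by
  induction k generalizing r with
  | zero => simp at hrk; omega
  | succ k ih =>
    rw [pow_succ] at hrk ⊢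
    have hq : 2 ^ k * 2 * q = 2 * (2 ^ k * q) := by ring
    obtain ⟨c, hc | hc⟩ := Nat.even_or_odd' r
    · have h := Nat.choose_two_mul_add_modEq (2 ^ k * q + (2 ^ k - 1 - c)) c 1 0
        (by norm_num) (by norm_num)
      rw [show 2 ^ k * 2 * q + (2 ^ k * 2 - 1 - r) = 2 * (2 ^ k * q + (2 ^ k - 1 - c)) + 1 by omega,
        show r = 2 * c + 0 by omega]
      rw [h.dvd_iff dvd_rfl]
      simpa using ih c (by omega) (by omega)
    · have h := Nat.choose_two_mul_add_modEq (2 ^ k * q + (2 ^ k - 1 - c)) c 0 1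
        (by norm_num) (by norm_num)
      rw [show 2 ^ k * 2 * q + (2 ^ k * 2 - 1 - r) = 2 * (2 ^ k * q + (2 ^ k - 1 - c)) + 0 by omega,
        show r = 2 * c + 1 by omega]
      rw [h.dvd_iff dvd_rfl]
      simp

theorem Nat.odd_choose_two_pow (v q : ℕ) :
    Odd ((2 ^ (v + 1) * q + (2 ^ (v + 1) - 1)).choose (2 ^ v)) := by
  rw [Nat.odd_iff]
  induction v with
  | zero => simp
  | succ v ih =>
    have h := Nat.choose_two_mul_add_modEq (2 ^ (v + 1) * q + (2 ^ (v + 1) - 1)) (2 ^ v) 1 0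
      (by norm_num) (by norm_num)
    have hq : 2 ^ (v + 1) * 2 * q = 2 * (2 ^ (v + 1) * q) := by ring
    have hp := Nat.one_le_two_pow (n := v + 1)
    rw [pow_succ 2 (v + 1), show 2 ^ (v + 1) * 2 * q + (2 ^ (v + 1) * 2 - 1) =
      2 * (2 ^ (v + 1) * q + (2 ^ (v + 1) - 1)) + 1 by omega]
    rw [Nat.choose_zero_right, one_mul, add_zero, ← pow_succ'] at h
    exact Eq.trans h ih

theorem two_dvd_Rpoly_coeff {n a b s m i : ℕ} (hab : b < a)
    (hn : n = 2 ^ a + 2 ^ b - 1) (hs : s + 2 * m + 2 ≤ n - 1)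
    (hsi : s + (2 * m + 2 * i + 2) ≤ n) (hj : m + 1 + i = 2 ^ (a - 1) ∨ m + 1 + i = 2 ^ b) :
    2 ∣ m.choose i * (s + 1 + m - i).choose (n - (2 * m + 2 * i + 2) - s) := by
  obtain rfl | hi := Nat.eq_zero_or_pos i
  · obtain ⟨c, rfl⟩ := Nat.exists_eq_add_of_lt hab
    simp only [Nat.add_sub_cancel] at hj
    have hc : 2 ^ (b + c) = 2 ^ b * 2 ^ c := pow_add ..
    have hc' : 2 ^ (b + c + 1) = 2 * 2 ^ (b + c) := by ring
    have hbp := Nat.one_le_two_pow (n := b)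
    refine Dvd.dvd.mul_left ?_ _
    rcases hj with hj | hj
    · have h := Nat.two_dvd_choose_two_pow_sub_one_sub b (2 ^ c)
        (n - (2 * m + 2 * 0 + 2) - s) (by omega) (by omega)
      rwa [show 2 ^ b * 2 ^ c + (2 ^ b - 1 - (n - (2 * m + 2 * 0 + 2) - s)) = s + 1 + m - 0
        by omega] at h
    · have h := Nat.two_dvd_choose_two_pow_sub_one_sub (b + c + 1) 0
        (n - (2 * m + 2 * 0 + 2) - s) (by omega) (by omega)
      rwa [show 2 ^ (b + c + 1) * 0 + (2 ^ (b + c + 1) - 1 - (n - (2 * m + 2 * 0 + 2) - s)) =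
        s + 1 + m - 0 by omega] at h
  · refine Dvd.dvd.mul_right ?_ _
    obtain ⟨k, hk⟩ : ∃ k, m + 1 + i = 2 ^ k := by rcases hj with h | h <;> exact ⟨_, h⟩
    have h := Nat.two_dvd_choose_two_pow_sub_one_sub k 0 i hi (by omega)
    rwa [show 2 ^ k * 0 + (2 ^ k - 1 - i) = m by omega] at h

theorem exists_odd_Rpoly_leading_coeff {n a b j : ℕ} (hab : b < a) (hb : 0 < b)
    (hn : n = 2 ^ a + 2 ^ b - 1) (hj : 1 ≤ j) (hjn : j ≤ (n - 1) / 2)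
    (hja : j ≠ 2 ^ (a - 1)) (hjb : j ≠ 2 ^ b) :
    ∃ s, s + 2 * j ≤ n - 1 ∧ Odd ((s + j).choose (n - 2 * j - s)) := by
  have hbp := Nat.one_le_two_pow (n := b)
  have hap := Nat.one_le_two_pow (n := a)
  obtain ⟨v, o, ho, hv⟩ := Nat.exists_eq_two_pow_mul_odd (n := n + 1 - j) (by omega)
  obtain ⟨u, rfl⟩ := ho
  have hvp := Nat.one_le_two_pow (n := v)
  have hv1 : 2 ^ (v + 1) = 2 * 2 ^ v := by ring
  have hv' : n + 1 - j = 2 ^ (v + 1) * u + 2 ^ v := by rw [hv]; ring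
  have hba : 2 ^ b < 2 ^ a := Nat.pow_lt_pow_right (by norm_num) hab
  have ha1 : 2 ^ a = 2 * 2 ^ (a - 1) := by rw [← pow_succ']; congr 1; omega
  have hu : u ≠ 0 := by
    rintro rfl
    have h1 : a - 1 < v := (Nat.pow_lt_pow_iff_right (a := 2) (by norm_num)).1 (by omega)
    have h2 : v < a + 1 :=
      (Nat.pow_lt_pow_iff_right (a := 2) (by norm_num)).1 (by rw [pow_succ]; omega)
    obtain rfl : v = a := by omega
    omega
  have hbound : 2 ^ v ≤ n - 2 * j := by
    have hvu : 2 ^ (v + 1) ≤ 2 ^ (v + 1) * u := Nat.le_mul_of_pos_right _ (by omega)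
    have hva : v < a := (Nat.pow_lt_pow_iff_right (a := 2) (by norm_num)).1 (by omega)
    obtain ⟨A, hA⟩ : 2 ^ (v + 1) ∣ 2 ^ a := pow_dvd_pow 2 hva
    rcases lt_trichotomy v b with hvb | rfl | hvb
    · obtain ⟨B, hB⟩ : 2 ^ (v + 1) ∣ 2 ^ b := pow_dvd_pow 2 hvb
      have hdvd : 2 ^ (v + 1) ∣ n + 1 - 2 * j := by
        rw [show n + 1 - 2 * j = 2 * (n + 1 - j) - (2 ^ a + 2 ^ b) by omega, hv', hA, hB]
        exact ⟨2 * u + 1 - (A + B), by rw [Nat.mul_sub]; congr 1 <;> ring⟩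
      have := Nat.le_of_dvd (by omega) hdvd
      omega
    · have hdvd : 2 ^ (v + 1) ∣ j := by
        rw [show j = 2 ^ a + 2 ^ v - (n + 1 - j) by omega, hv', hA]
        exact ⟨A - u, by rw [Nat.mul_sub]; omega⟩
      obtain ⟨J, hJ⟩ := hdvd
      have hlt : 2 ^ (v + 1) * (2 * J) < 2 ^ (v + 1) * (A + 1) := by
        rw [mul_add, ← hA, show 2 ^ (v + 1) * (2 * J) = 2 * (2 ^ (v + 1) * J) by ring, ← hJ]
        omega
      have hle : 2 * J ≤ A := by have := lt_of_mul_lt_mul_left' hlt; omega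
      have hne : 2 * J ≠ A := by
        rintro rfl
        rw [show 2 ^ (v + 1) * (2 * J) = 2 * (2 ^ (v + 1) * J) by ring, ← hJ] at hA
        omega
      have hle' := Nat.mul_le_mul_left (2 ^ (v + 1)) (show 2 * J + 1 ≤ A by omega)
      rw [← hA, show 2 ^ (v + 1) * (2 * J + 1) = 2 * (2 ^ (v + 1) * J) + 2 ^ (v + 1) by ring,
        ← hJ] at hle'
      omega
    · have hbv : 2 ^ b < 2 ^ v := Nat.pow_lt_pow_right (by norm_num) hvb
      have hdvd : 2 ^ (v + 1) ∣ n + 1 - 2 * j + 2 ^ b := by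
        rw [show n + 1 - 2 * j + 2 ^ b = 2 * (n + 1 - j) - 2 ^ a by omega, hv', hA]
        exact ⟨2 * u + 1 - A, by rw [Nat.mul_sub]; congr 1; ring⟩
      have := Nat.le_of_dvd (by omega) hdvd
      omega
  obtain ⟨q, rfl⟩ := Nat.exists_eq_succ_of_ne_zero hu
  have hq : 2 ^ (v + 1) * (q + 1) = 2 ^ (v + 1) * q + 2 ^ (v + 1) := by ring
  refine ⟨n - 2 * j - 2 ^ v, by omega, ?_⟩
  convert Nat.odd_choose_two_pow v q using 2 <;> simp only [Nat.succ_eq_add_one] at * <;> omega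

/-- Let `n = 2^a + 2^b − 1` with `a > b > 0`.  Then `𝓡₊` equals the `ℤ/2`-linear span of the
monomials `x^j·t^(n−2j)` for `1 ≤ j ≤ (n−1)/2` with `j ≠ 2^(a−1)` and `j ≠ 2^b`. -/
theorem stmt11 (n a b : ℕ) (hab : b < a) (hb : 0 < b) (hn : n = 2 ^ a + 2 ^ b - 1) :
    Rplus n =
      Submodule.span (ZMod 2)
        {q : MvPolynomial (Fin 2) (ZMod 2) |
          ∃ j : ℕ, 1 ≤ j ∧ j ≤ (n - 1) / 2 ∧ j ≠ 2 ^ (a - 1) ∧ j ≠ 2 ^ b ∧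
            q = X 0 ^ j * X 1 ^ (n - 2 * j)} := by
  have hodd : n % 2 = 1 := by
    obtain ⟨c, rfl⟩ := Nat.exists_eq_add_of_lt hab
    obtain ⟨d, rfl⟩ := Nat.exists_eq_add_of_lt hb
    have := Nat.one_le_two_pow (n := d)
    have h1 : 2 ^ (0 + d + 1) = 2 * 2 ^ d := by ring
    have h2 : 2 ^ (0 + d + 1 + c + 1) = 2 * 2 ^ (d + 1 + c) := by ring
    omega
  have hterm (P : Submodule (ZMod 2) (MvPolynomial (Fin 2) (ZMod 2))) (s m i : ℕ)
      (hs : s + 2 * m + 2 ≤ n - 1)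
      (hP : m + 1 + i ≤ (n - 1) / 2 → m + 1 + i ≠ 2 ^ (a - 1) → m + 1 + i ≠ 2 ^ b →
        X 0 ^ (m + 1 + i) * X 1 ^ (n - 2 * (m + 1 + i)) ∈ P) :
      (if 2 * m + 2 * i + 2 ≤ n then
        (if s ≤ n - (2 * m + 2 * i + 2) then
          ((m.choose i * (s + 1 + m - i).choose (n - (2 * m + 2 * i + 2) - s) : ℕ) : ZMod 2)
        else 0) •
        (X 0 ^ (m + 1 + i) * X 1 ^ (n - (2 * m + 2 * i + 2)))
      else 0) ∈ P := by
    split_ifs with h1 h2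
    · by_cases hj : m + 1 + i = 2 ^ (a - 1) ∨ m + 1 + i = 2 ^ b
      · rw [(ZMod.natCast_eq_zero_iff _ 2).2
          (two_dvd_Rpoly_coeff hab hn hs (by omega) hj), zero_smul]
        exact P.zero_mem
      · push Not at hj
        rw [show 2 * m + 2 * i + 2 = 2 * (m + 1 + i) by ring]
        exact P.smul_mem _ (hP (by omega) hj.1 hj.2)
    · simp
    · simp
  apply le_antisymm
  · refine Submodule.span_le.2 ?_
    rintro _ ⟨s, m, hs, rfl⟩
    exact Submodule.sum_mem _ fun i _ ↦ hterm _ s m i hs fun h1 h2 h3 ↦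
      Submodule.subset_span ⟨m + 1 + i, by omega, h1, h2, h3, rfl⟩
  · refine Submodule.span_le.2 ?_
    rintro _ ⟨j, hj, hjn, hja, hjb, rfl⟩
    induction hd : n - j using Nat.strong_induction_on generalizing j with
    | _ d ih =>
      obtain ⟨s, hs, hodd'⟩ := exists_odd_Rpoly_leading_coeff hab hb hn hj hjn hja hjb
      obtain ⟨m, rfl⟩ := Nat.exists_eq_add_of_le' hj
      have hmem : Rpoly n s m ∈ Rplus n := Submodule.subset_span ⟨s, m, by omega, rfl⟩
      rw [Rpoly, Finset.sum_range_succ', Submodule.add_mem_iff_right _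
        (Submodule.sum_mem _ fun i _ ↦ hterm _ s m (i + 1) (by omega) fun h1 h2 h3 ↦
          ih _ (by omega) _ (by omega) h1 h2 h3 rfl)] at hmem
      rw [if_pos (by omega), if_pos (by omega), Nat.choose_zero_right, one_mul,
        show s + 1 + m - 0 = s + (m + 1) by omega,
        show 2 * m + 2 * 0 + 2 = 2 * (m + 1) by ring,
        (ZMod.natCast_eq_one_iff_odd).2 hodd', one_smul] at hmem
      exact hmem
end

section
/- Let n be an even positive integer that is not a power of 2. Then 𝓡₊ equals the ℤ/2-linear span of the monomials x^j·t^{n−2j} for 1 ≤ j ≤ n/2. -/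
open MvPolynomial

/-- The total Steenrod square on `(ℤ/2)[x, t]`, with a bookkeeping variable. -/
noncomputable def totalSq : MvPolynomial (Fin 2) (ZMod 2) →ₐ[ZMod 2]
    Polynomial (MvPolynomial (Fin 2) (ZMod 2)) :=
  aeval ![Polynomial.C (X 0) * (1 + Polynomial.C (X 1) * Polynomial.X +
      Polynomial.C (X 0) * Polynomial.X ^ 2),
    Polynomial.C (X 1) * (1 + Polynomial.C (X 1) * Polynomial.X)]

/-- The coefficient at `z ^ k` of `(1 + t z) * totalSq f`, as a linear map. -/
noncomputable def twistedSq (k : ℕ) : MvPolynomial (Fin 2) (ZMod 2) →ₗ[ZMod 2]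
    MvPolynomial (Fin 2) (ZMod 2) where
  toFun f := ((1 + Polynomial.C (X 1) * Polynomial.X) * totalSq f).coeff k
  map_add' f g := by simp [mul_add]
  map_smul' c f := by simp

theorem twistedSq_apply (k : ℕ) (f : MvPolynomial (Fin 2) (ZMod 2)) :
    twistedSq k f = ((1 + Polynomial.C (X 1) * Polynomial.X) * totalSq f).coeff k := rfl

theorem coeff_one_add_C_mul_X_pow {R : Type*} [CommSemiring R] (r : R) (e k : ℕ) :
    ((1 + Polynomial.C r * Polynomial.X) ^ e).coeff k = e.choose k * r ^ k := by
  have h := Polynomial.comp_C_mul_X_coeff (p := (1 + Polynomial.X) ^ e) (r := r) (n := k)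
  rw [Polynomial.coeff_one_add_X_pow] at h
  simpa using h

theorem twistedSq_monomial (k s m : ℕ) :
    twistedSq k (X 1 ^ s * X 0 ^ m) = ∑ i ∈ Finset.range (m + 1),
      if 2 * i ≤ k then
        ((m.choose i * (s + 1 + m - i).choose (k - 2 * i) : ℕ) : MvPolynomial (Fin 2) (ZMod 2)) *
          (X 0 ^ (m + i) * X 1 ^ (s + (k - 2 * i)))
      else 0 := by
  have key : (1 + Polynomial.C (X 1) * Polynomial.X) * totalSq (X 1 ^ s * X 0 ^ m) =
      ∑ i ∈ Finset.range (m + 1),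
        Polynomial.C ((m.choose i : MvPolynomial (Fin 2) (ZMod 2)) * (X 1 ^ s * X 0 ^ (m + i))) *
          (Polynomial.X ^ (2 * i) *
            (1 + Polynomial.C (X 1) * Polynomial.X) ^ (s + 1 + m - i)) := by
    simp only [totalSq, map_mul, map_pow, aeval_X, Matrix.cons_val_zero, Matrix.cons_val_one]
    rw [add_comm (1 + _), mul_pow, mul_pow, add_pow _ _ m, Finset.mul_sum,
      Finset.mul_sum, Finset.mul_sum]
    refine Finset.sum_congr rfl fun i hi => ?_
    have hi' : i ≤ m := by simpa [Nat.lt_succ_iff] using hi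
    rw [show s + 1 + m - i = s + 1 + (m - i) by omega]
    simp only [map_natCast]
    ring
  rw [twistedSq_apply, key, Polynomial.finsetSum_coeff]
  refine Finset.sum_congr rfl fun i _ => ?_
  rw [Polynomial.coeff_C_mul, Polynomial.coeff_X_pow_mul']
  split_ifs with h
  · rw [coeff_one_add_C_mul_X_pow]
    push_cast
    ring
  · simp

theorem Rpoly_eq_X_mul_twistedSq (n s m : ℕ) (h : s + 2 * m + 2 ≤ n) :
    Rpoly n s m = X 0 * twistedSq (n - 2 - s - 2 * m) (X 1 ^ s * X 0 ^ m) := by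
  rw [twistedSq_monomial, Rpoly, Finset.mul_sum]
  refine Finset.sum_congr rfl fun i _ => ?_
  by_cases hi : 2 * i ≤ n - 2 - s - 2 * m
  · rw [if_pos (by omega), if_pos (by omega), if_pos hi,
      show n - (2 * m + 2 * i + 2) - s = n - 2 - s - 2 * m - 2 * i by omega,
      show n - (2 * m + 2 * i + 2) = s + (n - 2 - s - 2 * m - 2 * i) by omega,
      Algebra.smul_def, map_natCast]
    ring
  · rw [if_neg hi]
    split_ifs with h1 h2
    · omega
    · simp
    · simp

/-- The span of the monomials `t ^ s * x ^ m` of weight `s + 2 * m = d`. -/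
noncomputable def weightSpan (d : ℕ) : Submodule (ZMod 2) (MvPolynomial (Fin 2) (ZMod 2)) :=
  Submodule.span (ZMod 2) {p | ∃ s m : ℕ, s + 2 * m = d ∧ p = X 1 ^ s * X 0 ^ m}

/-- The elements of weight `d` hit by twisted squares of positive degree. -/
noncomputable def hitSpan (d : ℕ) : Submodule (ZMod 2) (MvPolynomial (Fin 2) (ZMod 2)) :=
  Submodule.span (ZMod 2)
    {p | ∃ s m k : ℕ, 0 < k ∧ s + 2 * m + k = d ∧ p = twistedSq k (X 1 ^ s * X 0 ^ m)}

theorem twistedSq_mem_hitSpan {d e k : ℕ} (hk : 0 < k) (hd : e + k = d)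
    {f : MvPolynomial (Fin 2) (ZMod 2)} (hf : f ∈ weightSpan e) :
    twistedSq k f ∈ hitSpan d := by
  have : weightSpan e ≤ (hitSpan d).comap (twistedSq k) := by
    refine Submodule.span_le.2 ?_
    rintro _ ⟨s, m, hsm, rfl⟩
    exact Submodule.subset_span ⟨s, m, k, hk, by omega, rfl⟩
  exact this hf

theorem X_mul_mem_Rplus {n : ℕ} {f : MvPolynomial (Fin 2) (ZMod 2)} (hn : 2 ≤ n)
    (hf : f ∈ hitSpan (n - 2)) : X 0 * f ∈ Rplus n := by
  have : hitSpan (n - 2) ≤ (Rplus n).comap (LinearMap.mulLeft (ZMod 2) (X 0)) := by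
    refine Submodule.span_le.2 ?_
    rintro _ ⟨s, m, k, hk, hsm, rfl⟩
    refine Submodule.subset_span ⟨s, m, by omega, ?_⟩
    rw [Rpoly_eq_X_mul_twistedSq n s m (by omega), show n - 2 - s - 2 * m = k by omega]
    rfl
  exact this hf

theorem t_mul_mem_weightSpan {d e : ℕ} (h : d + 1 = e) {f : MvPolynomial (Fin 2) (ZMod 2)}
    (hf : f ∈ weightSpan d) : X 1 * f ∈ weightSpan e := by
  have : weightSpan d ≤ (weightSpan e).comap (LinearMap.mulLeft (ZMod 2) (X 1)) := by
    refine Submodule.span_le.2 ?_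
    rintro _ ⟨s, m, hsm, rfl⟩
    exact Submodule.subset_span ⟨s + 1, m, by omega, by simp; ring⟩
  exact this hf

theorem x_pow_mul_mem_weightSpan {d e j : ℕ} (h : d + 2 * j = e)
    {f : MvPolynomial (Fin 2) (ZMod 2)} (hf : f ∈ weightSpan d) :
    X 0 ^ j * f ∈ weightSpan e := by
  have : weightSpan d ≤ (weightSpan e).comap (LinearMap.mulLeft (ZMod 2) (X 0 ^ j)) := by
    refine Submodule.span_le.2 ?_
    rintro _ ⟨s, m, hsm, rfl⟩
    exact Submodule.subset_span ⟨s, m + j, by omega, by simp; ring⟩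
  exact this hf

/-- The polynomial in `x = a b` and `t = a + b` equal to `(a ^ k + b ^ k) / (a + b)`. -/
noncomputable def powerQuot : ℕ → MvPolynomial (Fin 2) (ZMod 2)
  | 0 => 0
  | 1 => 1
  | k + 2 => X 1 * powerQuot (k + 1) + X 0 * powerQuot k

theorem powerQuot_mem_weightSpan (k : ℕ) : powerQuot (k + 1) ∈ weightSpan k := by
  induction k using Nat.twoStepInduction with
  | zero => exact Submodule.subset_span ⟨0, 0, by simp, by simp [powerQuot]⟩
  | one => exact Submodule.subset_span ⟨1, 0, by simp, by simp [powerQuot]⟩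
  | more k h0 h1 =>
    rw [powerQuot]
    refine add_mem (t_mul_mem_weightSpan rfl h1) ?_
    simpa using x_pow_mul_mem_weightSpan (j := 1) rfl h0

/-- The embedding of `(ℤ/2)[x, t]` as symmetric polynomials, `x = a b` and `t = a + b`. -/
noncomputable def symmHom : MvPolynomial (Fin 2) (ZMod 2) →ₐ[ZMod 2]
    MvPolynomial (Fin 2) (ZMod 2) :=
  aeval ![X 0 * X 1, X 0 + X 1]

theorem symmHom_injective : Function.Injective symmHom := by
  have h : symmHom = ((symmetricSubalgebra (Fin 2) (ZMod 2)).val.comp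
      (esymmAlgHom (Fin 2) (ZMod 2) 2)).comp (rename (Equiv.swap 0 1)) := by
    have h2 : esymm (Fin 2) (ZMod 2) 2 = X 0 * X 1 := by
      rw [esymm, show (Finset.univ : Finset (Fin 2)).powersetCard 2 = {Finset.univ} by decide]
      simp
    refine algHom_ext fun i => ?_
    fin_cases i
    · simp [symmHom, esymmAlgHom, h2]
    · simp [symmHom, esymmAlgHom, esymm_one]
  rw [h]
  exact (Subtype.val_injective.comp (esymmAlgHom_fin_injective (ZMod 2) le_rfl)).comp
    (rename_injective _ (Equiv.injective _))

/-- The linear map `f ↦ (a + b) f(a b, a + b)`. -/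
noncomputable def thomMap : MvPolynomial (Fin 2) (ZMod 2) →ₗ[ZMod 2]
    MvPolynomial (Fin 2) (ZMod 2) :=
  LinearMap.mulLeft (ZMod 2) (X 0 + X 1) ∘ₗ symmHom.toLinearMap

theorem thomMap_apply (f : MvPolynomial (Fin 2) (ZMod 2)) :
    thomMap f = (X 0 + X 1) * symmHom f := rfl

theorem thomMap_injective : Function.Injective thomMap := by
  have h : (X 0 + X 1 : MvPolynomial (Fin 2) (ZMod 2)) ≠ 0 := fun h0 => by
    have := congrArg (eval ![1, 0]) h0
    simp at this
  intro f g hfg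
  exact symmHom_injective (mul_left_cancel₀ h hfg)

theorem thomMap_powerQuot (k : ℕ) : thomMap (powerQuot k) = X 0 ^ k + X 1 ^ k := by
  induction k using Nat.twoStepInduction with
  | zero => simp [powerQuot, CharTwo.add_self_eq_zero]
  | one => simp [powerQuot, thomMap_apply]
  | more k h0 h1 =>
    rw [thomMap_apply] at *
    have hx : symmHom (X 0) = X 0 * X 1 := by simp [symmHom]
    have ht : symmHom (X 1) = X 0 + X 1 := by simp [symmHom]
    rw [powerQuot, map_add, map_mul, map_mul, hx, ht]
    have h2 : (2 : MvPolynomial (Fin 2) (ZMod 2)) = 0 := CharTwo.two_eq_zero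
    linear_combination (X 0 + X 1) * h1 + X 0 * X 1 * h0 +
      (X 0 ^ (k + 1) * X 1 + X 0 * X 1 ^ (k + 1)) * h2

/-- The total Steenrod square on `(ℤ/2)[a, b]`, with a bookkeeping variable. -/
noncomputable def totalSqRoots : MvPolynomial (Fin 2) (ZMod 2) →ₐ[ZMod 2]
    Polynomial (MvPolynomial (Fin 2) (ZMod 2)) :=
  aeval fun i => Polynomial.C (X i) * (1 + Polynomial.C (X i) * Polynomial.X)

theorem totalSqRoots_symmHom (f : MvPolynomial (Fin 2) (ZMod 2)) :
    totalSqRoots (symmHom f) = (totalSq f).map symmHom.toRingHom := by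
  have h : totalSqRoots.comp symmHom = (Polynomial.mapAlgHom symmHom).comp totalSq := by
    have h2 : (2 : Polynomial (MvPolynomial (Fin 2) (ZMod 2))) = 0 := CharTwo.two_eq_zero
    refine algHom_ext fun i => ?_
    fin_cases i
    · simp [totalSqRoots, totalSq, symmHom]
      ring
    · simp [totalSqRoots, totalSq, symmHom]
      linear_combination (- Polynomial.C (X 0) * Polynomial.C (X 1) * Polynomial.X) * h2
  exact DFunLike.congr_fun h f

theorem coeff_totalSqRoots_thomMap (k : ℕ) (f : MvPolynomial (Fin 2) (ZMod 2)) :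
    (totalSqRoots (thomMap f)).coeff k = thomMap (twistedSq k f) := by
  have h2 : (2 : Polynomial (MvPolynomial (Fin 2) (ZMod 2))) = 0 := CharTwo.two_eq_zero
  have h : totalSqRoots (thomMap f) = Polynomial.C (X 0 + X 1) *
      ((1 + Polynomial.C (X 1) * Polynomial.X) * totalSq f).map symmHom.toRingHom := by
    rw [thomMap_apply, map_mul, totalSqRoots_symmHom, Polynomial.map_mul, ← mul_assoc]
    congr 1
    simp [totalSqRoots, symmHom]
    linear_combination (- Polynomial.C (X 0) * Polynomial.C (X 1) * Polynomial.X) * h2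
  rw [h, Polynomial.coeff_C_mul, Polynomial.coeff_map]
  rfl

/-- Symmetrized monomials come from homogeneous elements. -/
theorem exists_thomMap_eq {i j d : ℕ} (h : i + j = d + 1) :
    ∃ f ∈ weightSpan d, thomMap f = X 0 ^ i * X 1 ^ j + X 1 ^ i * X 0 ^ j := by
  have hx : symmHom (X 0) = X 0 * X 1 := by simp [symmHom]
  have aux : ∀ j l : ℕ, thomMap (X 0 ^ j * powerQuot l) =
      X 0 ^ (l + j) * X 1 ^ j + X 1 ^ (l + j) * X 0 ^ j := by
    intro j l
    have := thomMap_powerQuot l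
    rw [thomMap_apply] at *
    rw [map_mul, map_pow, hx]
    linear_combination (X 0 * X 1) ^ j * this
  rcases lt_trichotomy i j with hij | rfl | hij
  · obtain ⟨l, rfl⟩ := Nat.exists_eq_add_of_lt hij
    refine ⟨X 0 ^ i * powerQuot (l + 1),
      x_pow_mul_mem_weightSpan (by omega) (powerQuot_mem_weightSpan l), ?_⟩
    rw [aux]
    ring
  · exact ⟨0, zero_mem _, by rw [map_zero, mul_comm (X 1 ^ i), CharTwo.add_self_eq_zero]⟩
  · obtain ⟨l, rfl⟩ := Nat.exists_eq_add_of_lt hij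
    refine ⟨X 0 ^ j * powerQuot (l + 1),
      x_pow_mul_mem_weightSpan (by omega) (powerQuot_mem_weightSpan l), ?_⟩
    rw [aux]
    ring

theorem coeff_totalSqRoots_monomial {c d : Fin 2} (p q : ℕ) :
    (totalSqRoots (X c ^ p * X d ^ q)).coeff (p + q) = (X c ^ p * X d ^ q) ^ 2 := by
  have h1 : ∀ c : Fin 2, (1 + Polynomial.C (X c : MvPolynomial (Fin 2) (ZMod 2)) *
      Polynomial.X).natDegree ≤ 1 := fun c => by compute_degree
  have h : totalSqRoots (X c ^ p * X d ^ q) = Polynomial.C (X c ^ p * X d ^ q) *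
      ((1 + Polynomial.C (X c) * Polynomial.X) ^ p *
        (1 + Polynomial.C (X d) * Polynomial.X) ^ q) := by
    simp only [totalSqRoots, map_mul, map_pow, aeval_X, mul_pow]
    ring
  have hp := Polynomial.natDegree_pow_le_of_le p (h1 c)
  have hq := Polynomial.natDegree_pow_le_of_le q (h1 d)
  rw [mul_one] at hp hq
  rw [h, Polynomial.coeff_C_mul, Polynomial.coeff_mul_add_eq_of_natDegree_le hp hq,
    coeff_one_add_C_mul_X_pow, coeff_one_add_C_mul_X_pow]
  simp
  ring

theorem sum_X_pow_mul_totalSqRoots (c : Fin 2) (R : ℕ) :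
    ∑ r ∈ Finset.range R, Polynomial.X ^ (2 ^ r - 1) * totalSqRoots (X c ^ 2 ^ r) =
      Polynomial.C (X c) + Polynomial.X ^ (2 ^ R - 1) * Polynomial.C (X c ^ 2 ^ R) := by
  have h2 : (2 : Polynomial (MvPolynomial (Fin 2) (ZMod 2))) = 0 := CharTwo.two_eq_zero
  induction R with
  | zero => simp [CharTwo.add_self_eq_zero]
  | succ R ih =>
    have hq : totalSqRoots (X c ^ 2 ^ R) =
        Polynomial.C (X c) ^ 2 ^ R + Polynomial.C (X c) ^ 2 ^ (R + 1) * Polynomial.X ^ 2 ^ R := by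
      have : totalSqRoots (X c) =
          Polynomial.C (X c) + Polynomial.C (X c) ^ 2 * Polynomial.X := by
        simp [totalSqRoots]; ring
      rw [map_pow, this, add_pow_char_pow, mul_pow, ← pow_mul, pow_succ']
    have hpos : 0 < 2 ^ R := by positivity
    rw [Finset.sum_range_succ, ih, hq, show 2 ^ (R + 1) - 1 = 2 ^ R - 1 + 2 ^ R by
      rw [pow_succ]; omega, pow_add]
    simp only [map_pow]
    linear_combination Polynomial.X ^ (2 ^ R - 1) * Polynomial.C (X c) ^ 2 ^ R * h2

/-- The `χ`-trick: `c h²` is a sum of Steenrod squares when `h` has degree `k`. -/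
theorem sum_coeff_totalSqRoots (c d : Fin 2) (p q R : ℕ) (hR : p + q < 2 ^ R - 1) :
    ∑ r ∈ Finset.range R, (Polynomial.X ^ (2 ^ r - 1) *
      totalSqRoots (X c ^ (2 ^ r + p) * X d ^ q)).coeff (p + q) =
        X c ^ (2 * p + 1) * X d ^ (2 * q) := by
  have h : ∑ r ∈ Finset.range R, Polynomial.X ^ (2 ^ r - 1) *
      totalSqRoots (X c ^ (2 ^ r + p) * X d ^ q) =
      Polynomial.C (X c) * totalSqRoots (X c ^ p * X d ^ q) +
        Polynomial.X ^ (2 ^ R - 1) *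
          (Polynomial.C (X c ^ 2 ^ R) * totalSqRoots (X c ^ p * X d ^ q)) := by
    rw [← mul_assoc, ← add_mul, ← sum_X_pow_mul_totalSqRoots, Finset.sum_mul]
    refine Finset.sum_congr rfl fun r _ => ?_
    rw [mul_assoc, ← map_mul]
    ring_nf
  rw [← Polynomial.finsetSum_coeff, h, Polynomial.coeff_add, Polynomial.coeff_C_mul,
    coeff_totalSqRoots_monomial, Polynomial.coeff_X_pow_mul', if_neg (by omega)]
  ring

theorem exists_hit_of_symmetrized (k : ℕ) (hk : ∀ r, k + 1 ≠ 2 ^ r) (p q : ℕ) (hpq : p + q = k) :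
    ∃ f ∈ hitSpan (2 * k),
      thomMap f = X 0 ^ (2 * p + 1) * X 1 ^ (2 * q) + X 1 ^ (2 * p + 1) * X 0 ^ (2 * q) := by
  subst hpq
  have hR : p + q < 2 ^ (p + q + 1) - 1 := by
    have h1 : p + q + 1 < 2 ^ (p + q + 1) := Nat.lt_two_pow_self
    omega
  change _ ∈ (hitSpan (2 * (p + q))).map thomMap
  rw [← sum_coeff_totalSqRoots 0 1 p q _ hR, ← sum_coeff_totalSqRoots 1 0 p q _ hR,
    ← Finset.sum_add_distrib]
  refine sum_mem fun r _ => ?_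
  rw [← Polynomial.coeff_add, ← mul_add, ← map_add, Polynomial.coeff_X_pow_mul']
  split_ifs with h
  · have hpos : 0 < 2 ^ r := by positivity
    obtain ⟨f, hf, hfe⟩ := exists_thomMap_eq (i := 2 ^ r + p) (j := q) (d := 2 ^ r - 1 + (p + q))
      (by omega)
    rw [← hfe, coeff_totalSqRoots_thomMap]
    have := hk r
    exact ⟨_, twistedSq_mem_hitSpan (by omega) (by omega) hf, rfl⟩
  · exact zero_mem _

theorem x_pow_mul_powerQuot_mem_hitSpan (k : ℕ) (hk : ∀ r, k + 1 ≠ 2 ^ r) (s m : ℕ)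
    (h : s + 2 * m = 2 * k) : X 0 ^ m * powerQuot (s + 1) ∈ hitSpan (2 * k) := by
  have hx : symmHom (X 0) = X 0 * X 1 := by simp [symmHom]
  have hP := thomMap_powerQuot (s + 1)
  have key : ∃ f ∈ hitSpan (2 * k), thomMap f = thomMap (X 0 ^ m * powerQuot (s + 1)) := by
    rw [thomMap_apply] at hP
    rw [thomMap_apply (X 0 ^ m * _), map_mul, map_pow, hx]
    rcases Nat.even_or_odd' m with ⟨q, rfl | rfl⟩
    · obtain ⟨f, hf, hfe⟩ := exists_hit_of_symmetrized k hk (k - q) q (by omega)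
      refine ⟨f, hf, ?_⟩
      rw [show 2 * (k - q) + 1 = 2 * q + (s + 1) by omega] at hfe
      linear_combination hfe - (X 0 * X 1) ^ (2 * q) * hP
    · obtain ⟨f, hf, hfe⟩ := exists_hit_of_symmetrized k hk q (k - q) (by omega)
      refine ⟨f, hf, ?_⟩
      rw [show 2 * (k - q) = 2 * q + 1 + (s + 1) by omega] at hfe
      linear_combination hfe - (X 0 * X 1) ^ (2 * q + 1) * hP
  obtain ⟨f, hf, hfe⟩ := key
  rwa [← thomMap_injective hfe]

theorem exists_X_pow_eq_powerQuot_add (s : ℕ) :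
    ∃ g ∈ weightSpan s, X 1 ^ (s + 2) = powerQuot (s + 3) + X 0 * g := by
  induction s with
  | zero =>
    refine ⟨-powerQuot 1, neg_mem (powerQuot_mem_weightSpan 0), ?_⟩
    simp only [powerQuot]
    ring
  | succ s ih =>
    obtain ⟨g, hg, h⟩ := ih
    refine ⟨X 1 * g - powerQuot (s + 2),
      sub_mem (t_mul_mem_weightSpan rfl hg) (powerQuot_mem_weightSpan (s + 1)), ?_⟩
    rw [show s + 1 + 3 = s + 2 + 2 from rfl, powerQuot]
    linear_combination X 1 * h

theorem x_pow_mul_monomial_sub_powerQuot_mem (s m : ℕ)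
    (H : Submodule (ZMod 2) (MvPolynomial (Fin 2) (ZMod 2)))
    (hH : ∀ s' m', s' < s → s' + 2 * m' = s + 2 * m → X 1 ^ s' * X 0 ^ m' ∈ H) :
    X 0 ^ m * (X 1 ^ s - powerQuot (s + 1)) ∈ H := by
  match s with
  | 0 => simp [powerQuot]
  | 1 => simp [powerQuot]
  | s + 2 =>
    obtain ⟨g, hg, h⟩ := exists_X_pow_eq_powerQuot_add s
    have hle : weightSpan s ≤ H.comap (LinearMap.mulLeft (ZMod 2) (X 0 ^ (m + 1))) := by
      refine Submodule.span_le.2 ?_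
      rintro _ ⟨s', m', hs, rfl⟩
      have := hH s' (m' + (m + 1)) (by omega) (by omega)
      change X 0 ^ (m + 1) * (X 1 ^ s' * X 0 ^ m') ∈ H
      convert this using 1
      ring
    rw [h, add_sub_cancel_left, ← mul_assoc, ← pow_succ]
    exact hle hg

theorem monomial_mem_hitSpan (k : ℕ) (hk : ∀ r, k + 1 ≠ 2 ^ r) (s m : ℕ)
    (h : s + 2 * m = 2 * k) : X 1 ^ s * X 0 ^ m ∈ hitSpan (2 * k) := by
  induction s using Nat.strong_induction_on generalizing m with
  | _ s ih =>
    have h1 := x_pow_mul_monomial_sub_powerQuot_mem s m (hitSpan (2 * k))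
      fun s' m' hs hs' => ih s' hs m' (by omega)
    have h2 := add_mem h1 (x_pow_mul_powerQuot_mem_hitSpan k hk s m h)
    convert h2 using 1
    ring

/-- Let `n` be an even positive integer that is not a power of `2`.  Then `𝓡₊` equals the
`ℤ/2`-linear span of the monomials `x^j·t^(n−2j)`, `1 ≤ j ≤ n/2`. -/
theorem stmt12 (n : ℕ) (hn : Even n) (hpos : 0 < n)
    (hnotpow : ¬ ∃ a : ℕ, n = 2 ^ a) :
    Rplus n =
      Submodule.span (ZMod 2)
        {q : MvPolynomial (Fin 2) (ZMod 2) |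
          ∃ j : ℕ, 1 ≤ j ∧ j ≤ n / 2 ∧ q = X 0 ^ j * X 1 ^ (n - 2 * j)} := by
  apply le_antisymm
  · refine Submodule.span_le.2 ?_
    rintro _ ⟨s, m, -, rfl⟩
    refine sum_mem fun i _ => ?_
    split_ifs with h1 h2
    · exact Submodule.smul_mem _ _ (Submodule.subset_span
        ⟨m + 1 + i, by omega, by omega, by congr 2; omega⟩)
    · rw [zero_smul]
      exact zero_mem _
    · exact zero_mem _
  · refine Submodule.span_le.2 ?_
    rintro _ ⟨j, hj1, hj2, rfl⟩
    obtain ⟨k, rfl⟩ : ∃ k, n = 2 * k + 2 := by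
      obtain ⟨l, rfl⟩ := hn
      exact ⟨l - 1, by omega⟩
    have hk : ∀ r, k + 1 ≠ 2 ^ r := fun r hr => hnotpow ⟨r + 1, by rw [pow_succ]; omega⟩
    have h := X_mul_mem_Rplus (n := 2 * k + 2) (by omega)
      (monomial_mem_hitSpan k hk (2 * k + 2 - 2 * j) (j - 1) (by omega))
    rwa [mul_left_comm, ← pow_succ', Nat.sub_add_cancel hj1, mul_comm (X 1 ^ _)] at h
end
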